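/- arXiv:1905.11504 — 3 statements merged into one kernel-verified Lean document; each statement's English description precedes it below -/
import Mathlib

section
/- For every M > 0 there exists α₀ such that for all α ≥ α₀, every solution u of problem (P_{α,λ*(α)}) (i.e. with parameter λ = λ*(α)) satisfies u(0) ≥ M. -/
open Set MeasureTheory Filter

/-- The standing data and assumptions of the Gelfand-type problem for
auto-ignition of a free round turbulent jet:
`f : [0,∞) → (0,∞)` is `C¹`, convex, non-decreasing with `K = ∫₀^∞ ds / f s < ∞`;
`φ, ψ : [0,1] → [0,∞)` are non-increasing Lipschitz with `φ 0 = ψ 0 = 1`,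
`φ > 0` on `[0,1)`, and `M s = max_{r ∈ [0,s]} ψ r / φ r` is integrable on `(0,1)`. -/
structure GelfandData where
  f : ℝ → ℝ
  phi : ℝ → ℝ
  psi : ℝ → ℝ
  M : ℝ → ℝ
  K : ℝ
  f_pos : ∀ s, 0 ≤ s → 0 < f s
  f_smooth : ContDiffOn ℝ 1 f (Ici 0)
  f_convex : ConvexOn ℝ (Ici 0) f
  f_mono : MonotoneOn f (Ici 0)
  f_int : IntegrableOn (fun s => 1 / f s) (Ioi 0)
  K_def : K = ∫ s in Ioi (0:ℝ), 1 / f s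
  phi_nonneg : ∀ r ∈ Icc (0:ℝ) 1, 0 ≤ phi r
  psi_nonneg : ∀ r ∈ Icc (0:ℝ) 1, 0 ≤ psi r
  phi_anti : AntitoneOn phi (Icc 0 1)
  psi_anti : AntitoneOn psi (Icc 0 1)
  phi_lip : ∃ L, LipschitzOnWith L phi (Icc 0 1)
  psi_lip : ∃ L, LipschitzOnWith L psi (Icc 0 1)
  phi_zero : phi 0 = 1
  psi_zero : psi 0 = 1
  phi_pos : ∀ r ∈ Ico (0:ℝ) 1, 0 < phi r
  M_def : ∀ s ∈ Ico (0:ℝ) 1, IsGreatest ((fun r => psi r / phi r) '' Icc 0 s) (M s)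
  M_int : IntegrableOn M (Ioo 0 1)

/-- `u` is a (classical, radial) solution of problem `(P_{α,λ})`:
`u ∈ C²((0,1)) ∩ C¹([0,1])`, `u > 0` on `[0,1)`, `u'(0) = 0`, `u 1 = 0`, and
`-u'' - (1/r + α r φ(r)) u' = λ ψ(r) f(u(r))` on `(0,1)`. -/
def IsSolution (D : GelfandData) (α lam : ℝ) (u : ℝ → ℝ) : Prop :=
  ContDiffOn ℝ 1 u (Icc 0 1) ∧ ContDiffOn ℝ 2 u (Ioo 0 1) ∧
  (∀ r ∈ Ico (0:ℝ) 1, 0 < u r) ∧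
  derivWithin u (Icc 0 1) 0 = 0 ∧ u 1 = 0 ∧
  ∀ r ∈ Ioo (0:ℝ) 1,
    -(derivWithin (derivWithin u (Icc 0 1)) (Ioo 0 1) r)
      - (1 / r + α * r * D.phi r) * derivWithin u (Icc 0 1) r
      = lam * D.psi r * D.f (u r)

/-- The set of `λ > 0` for which problem `(P_{α,λ})` admits a solution. -/
def solvableSet (D : GelfandData) (α : ℝ) : Set ℝ :=
  {lam | 0 < lam ∧ ∃ u, IsSolution D α lam u}

/-- The extremal Frank-Kamenetskii parameter `λ*(α)`. -/
noncomputable def lamStar (D : GelfandData) (α : ℝ) : ℝ := sSup (solvableSet D α)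

/-- The weight `μ(r) = exp(α ∫₀^r s φ(s) ds)`. -/
noncomputable def muW (D : GelfandData) (α r : ℝ) : ℝ :=
  Real.exp (α * ∫ s in (0:ℝ)..r, s * D.phi s)

/-- `u` is a semistable solution: for every `C¹` test function `η` with `η 1 = 0`,
`∫₀¹ η'^2 μ r dr ≥ λ ∫₀¹ ψ f'(u) η² μ r dr`. -/
def IsSemistable (D : GelfandData) (α lam : ℝ) (u : ℝ → ℝ) : Prop :=
  ∀ η : ℝ → ℝ, ContDiff ℝ 1 η → η 1 = 0 →
    lam * ∫ r in Ioo (0:ℝ) 1,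
        D.psi r * derivWithin D.f (Ici 0) (u r) * (η r) ^ 2 * muW D α r * r
      ≤ ∫ r in Ioo (0:ℝ) 1, (deriv η r) ^ 2 * muW D α r * r


noncomputable def cl (r : ℝ) : ℝ := max 0 (min r 1)
noncomputable def phiE (D : GelfandData) (r : ℝ) : ℝ := D.phi (cl r)
noncomputable def psiE (D : GelfandData) (r : ℝ) : ℝ := D.psi (cl r)
noncomputable def fE (D : GelfandData) (N s : ℝ) : ℝ := D.f (max 0 (min s N))
noncomputable def mu (D : GelfandData) (α r : ℝ) : ℝ :=
  Real.exp (α * ∫ s in (0:ℝ)..r, s * phiE D s)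

lemma cl_mem (r : ℝ) : cl r ∈ Icc (0:ℝ) 1 := by
  unfold cl; constructor
  · exact le_max_left _ _
  · exact max_le zero_le_one (min_le_right _ _)

lemma cl_of_mem {r : ℝ} (h : r ∈ Icc (0:ℝ) 1) : cl r = r := by
  unfold cl; rw [min_eq_left h.2, max_eq_right h.1]

lemma cl_cont : Continuous cl := by unfold cl; fun_prop

lemma cl_mono : Monotone cl := by
  intro a b h; unfold cl; gcongr

lemma phiE_cont (D : GelfandData) : Continuous (phiE D) := by
  obtain ⟨L, hL⟩ := D.phi_lip
  exact hL.continuousOn.comp_continuous cl_cont cl_mem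

lemma psiE_cont (D : GelfandData) : Continuous (psiE D) := by
  obtain ⟨L, hL⟩ := D.psi_lip
  exact hL.continuousOn.comp_continuous cl_cont cl_mem

lemma phiE_nonneg (D : GelfandData) (r : ℝ) : 0 ≤ phiE D r := D.phi_nonneg _ (cl_mem r)
lemma psiE_nonneg (D : GelfandData) (r : ℝ) : 0 ≤ psiE D r := D.psi_nonneg _ (cl_mem r)
lemma phiE_anti (D : GelfandData) : Antitone (phiE D) :=
  fun _ _ h => D.phi_anti (cl_mem _) (cl_mem _) (cl_mono h)
lemma psiE_anti (D : GelfandData) : Antitone (psiE D) :=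
  fun _ _ h => D.psi_anti (cl_mem _) (cl_mem _) (cl_mono h)
lemma phiE_zero (D : GelfandData) : phiE D 0 = 1 := by
  unfold phiE; rw [cl_of_mem (by simp)]; exact D.phi_zero
lemma psiE_zero (D : GelfandData) : psiE D 0 = 1 := by
  unfold psiE; rw [cl_of_mem (by simp)]; exact D.psi_zero
lemma phiE_le_one (D : GelfandData) (r : ℝ) : phiE D r ≤ 1 := by
  rw [← D.phi_zero]; exact D.phi_anti (by simp) (cl_mem _) (cl_mem _).1
lemma psiE_le_one (D : GelfandData) (r : ℝ) : psiE D r ≤ 1 := by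
  rw [← D.psi_zero]; exact D.psi_anti (by simp) (cl_mem _) (cl_mem _).1

lemma mu_pos (D : GelfandData) (α r : ℝ) : 0 < mu D α r := Real.exp_pos _

lemma mu_zero (D : GelfandData) (α : ℝ) : mu D α 0 = 1 := by simp [mu]

lemma mu_deriv (D : GelfandData) (α r : ℝ) :
    HasDerivAt (mu D α) (α * (r * phiE D r) * mu D α r) r := by
  have hc : Continuous (fun s => s * phiE D s) := continuous_id.mul (phiE_cont D)
  have h1 : HasDerivAt (fun r => ∫ s in (0:ℝ)..r, s * phiE D s) (r * phiE D r) r :=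
    intervalIntegral.integral_hasDerivAt_right (hc.intervalIntegrable _ _)
      hc.stronglyMeasurable.stronglyMeasurableAtFilter hc.continuousAt
  have := (h1.const_mul α).exp
  unfold mu
  convert this using 1
  ring

lemma mu_cont (D : GelfandData) (α : ℝ) : Continuous (mu D α) :=
  continuous_iff_continuousAt.2 fun r => (mu_deriv D α r).continuousAt

lemma mu_mono (D : GelfandData) {α : ℝ} (hα : 0 ≤ α) : MonotoneOn (mu D α) (Ici 0) := by
  apply monotoneOn_of_deriv_nonneg (convex_Ici 0) (mu_cont D α).continuousOn
  · intro x _; exact (mu_deriv D α x).differentiableAt.differentiableWithinAt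
  · intro x hx
    rw [interior_Ici] at hx
    rw [(mu_deriv D α x).deriv]
    have := phiE_nonneg D x
    have := (mu_pos D α x).le
    have := le_of_lt (mem_Ioi.1 hx)
    positivity

lemma mu_ge_one (D : GelfandData) {α r : ℝ} (hα : 0 ≤ α) (hr : 0 ≤ r) : 1 ≤ mu D α r := by
  rw [← mu_zero D α]; exact mu_mono D hα (by simp) hr hr

lemma clN_mem {N : ℝ} (hN : 0 ≤ N) (s : ℝ) : max 0 (min s N) ∈ Icc (0:ℝ) N :=
  ⟨le_max_left _ _, max_le hN (min_le_right _ _)⟩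

lemma fE_of_mem (D : GelfandData) {N s : ℝ} (h : s ∈ Icc (0:ℝ) N) : fE D N s = D.f s := by
  unfold fE; rw [min_eq_left h.2, max_eq_right h.1]

lemma fE_cont (D : GelfandData) (N : ℝ) : Continuous (fE D N) :=
  D.f_smooth.continuousOn.comp_continuous (by fun_prop) (fun _ => mem_Ici.2 (le_max_left _ _))

lemma fE_pos (D : GelfandData) (N s : ℝ) : 0 < fE D N s := D.f_pos _ (le_max_left _ _)

lemma fE_mono (D : GelfandData) (N : ℝ) : Monotone (fE D N) := by
  intro a b h
  exact D.f_mono (mem_Ici.2 (le_max_left _ _)) (mem_Ici.2 (le_max_left _ _)) (by gcongr)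

lemma fE_le (D : GelfandData) {N : ℝ} (hN : 0 ≤ N) (s : ℝ) : fE D N s ≤ D.f N :=
  D.f_mono (mem_Ici.2 (le_max_left _ _)) (mem_Ici.2 hN) (clN_mem hN s).2

/-- primitive of 1/f -/
noncomputable def FE (D : GelfandData) (N x : ℝ) : ℝ := ∫ s in (0:ℝ)..x, 1 / fE D N s

lemma FE_deriv (D : GelfandData) (N x : ℝ) : HasDerivAt (FE D N) (1 / fE D N x) x := by
  have hc : Continuous (fun s => 1 / fE D N s) :=
    continuous_const.div (fE_cont D N) (fun s => (fE_pos D N s).ne')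
  exact intervalIntegral.integral_hasDerivAt_right (hc.intervalIntegrable _ _)
      hc.stronglyMeasurable.stronglyMeasurableAtFilter hc.continuousAt

lemma FE_zero (D : GelfandData) (N : ℝ) : FE D N 0 = 0 := by simp [FE]

lemma FE_cont (D : GelfandData) (N : ℝ) : Continuous (FE D N) :=
  continuous_iff_continuousAt.2 fun r => (FE_deriv D N r).continuousAt

lemma FE_strictMono (D : GelfandData) (N : ℝ) : StrictMono (FE D N) := by
  apply strictMono_of_deriv_pos
  intro x
  rw [(FE_deriv D N x).deriv]
  exact one_div_pos.2 (fE_pos D N x)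

lemma FE_surj (D : GelfandData) {N : ℝ} (hN : 0 ≤ N) : Function.Surjective (FE D N) := by
  have hf : 0 < D.f N := D.f_pos N hN
  have hmono : Monotone (fun x => FE D N x - x / D.f N) := by
    apply monotone_of_deriv_nonneg
    · intro x
      exact ((FE_deriv D N x).sub ((hasDerivAt_id x).div_const _)).differentiableAt
    · intro x
      have h := ((FE_deriv D N x).sub ((hasDerivAt_id x).div_const (D.f N))).deriv
      have h2 : deriv (fun x => FE D N x - x / D.f N) x = 1 / fE D N x - 1 / D.f N := h
      rw [h2, sub_nonneg]
      exact one_div_le_one_div_of_le (fE_pos D N x) (fE_le D hN x)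
  have h0 : FE D N 0 - 0 / D.f N = 0 := by simp [FE_zero]
  have hlin : Tendsto (fun x : ℝ => x / D.f N) atTop atTop := tendsto_id.atTop_div_const hf
  have hlin2 : Tendsto (fun x : ℝ => x / D.f N) atBot atBot := tendsto_id.atBot_div_const hf
  apply (FE_cont D N).surjective
  · apply tendsto_atTop_mono' _ _ hlin
    filter_upwards [eventually_ge_atTop (0:ℝ)] with x hx
    have := hmono hx
    simp only [h0] at this; linarith
  · apply tendsto_atBot_mono' _ _ hlin2
    filter_upwards [eventually_le_atBot (0:ℝ)] with x hx
    have := hmono hx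
    simp only [h0] at this; linarith

lemma exists_W (D : GelfandData) {N : ℝ} (hN : 0 ≤ N) :
    ∃ W : ℝ → ℝ, StrictMono W ∧ Continuous W ∧ (∀ y, FE D N (W y) = y) ∧
      (∀ x, W (FE D N x) = x) ∧ ∀ y, HasDerivAt W (fE D N (W y)) y := by
  let e := (FE_strictMono D N).orderIsoOfSurjective _ (FE_surj D hN)
  have hl : ∀ y, FE D N (e.symm y) = y := fun y => e.apply_symm_apply y
  have hr : ∀ x, e.symm (FE D N x) = x := fun x => e.symm_apply_apply x
  refine ⟨e.symm, e.symm.strictMono, e.symm.continuous, hl, hr, fun y => ?_⟩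
  have := HasDerivAt.of_local_left_inverse (f := FE D N) (g := e.symm) (a := y)
    e.symm.continuous.continuousAt (FE_deriv D N (e.symm y))
    (one_div_pos.2 (fE_pos D N _)).ne' (Eventually.of_forall hl)
  simpa using this

lemma fE_deriv_bound (D : GelfandData) {N x : ℝ} (hx : 0 < x) (hxN : x < N) :
    ∃ d, HasDerivAt (fE D N) d x ∧ d ≤ D.f (N + 1) := by
  have hd : DifferentiableAt ℝ D.f x :=
    (D.f_smooth.differentiableOn (by norm_num)).differentiableAt (Ici_mem_nhds hx)
  refine ⟨deriv D.f x, ?_, ?_⟩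
  · refine hd.hasDerivAt.congr_of_eventuallyEq ?_
    filter_upwards [Ioo_mem_nhds hx hxN] with y hy
    exact fE_of_mem D ⟨hy.1.le, hy.2.le⟩
  · have h := D.f_convex.le_slope_of_hasDerivAt (x := x) (y := N + 1) (mem_Ici.2 hx.le)
      (mem_Ici.2 (by linarith)) (by linarith) hd.hasDerivAt
    refine h.trans ?_
    rw [slope_def_field]
    have h1 := D.f_pos x hx.le
    have h2 := D.f_pos (N+1) (by linarith)
    rw [div_le_iff₀ (by linarith)]
    nlinarith


lemma phiE_eq (D : GelfandData) {r : ℝ} (h : r ∈ Icc (0:ℝ) 1) : phiE D r = D.phi r := by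
  unfold phiE; rw [cl_of_mem h]
lemma psiE_eq (D : GelfandData) {r : ℝ} (h : r ∈ Icc (0:ℝ) 1) : psiE D r = D.psi r := by
  unfold psiE; rw [cl_of_mem h]

lemma sol_basic (D : GelfandData) {α lam : ℝ} {u : ℝ → ℝ} (h : IsSolution D α lam u) :
    ∃ v : ℝ → ℝ, ContinuousOn v (Icc 0 1) ∧ (∀ r ∈ Ioo (0:ℝ) 1, HasDerivAt u (v r) r) ∧
      (∀ r ∈ Ioo (0:ℝ) 1, HasDerivAt (fun r => -(r * mu D α r * v r))
        (r * mu D α r * (lam * psiE D r * D.f (u r))) r) := by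
  obtain ⟨h1, h2, hpos, hd0, hu1, hode⟩ := h
  refine ⟨derivWithin u (Icc 0 1), h1.continuousOn_derivWithin (uniqueDiffOn_Icc one_pos) le_rfl,
    ?_, ?_⟩
  · intro r hr
    exact ((h1.differentiableOn (by norm_num)) r
      (Ioo_subset_Icc_self hr)).hasDerivWithinAt.hasDerivAt (Icc_mem_nhds hr.1 hr.2)
  · intro r hr
    have heq : EqOn (derivWithin u (Icc 0 1)) (deriv u) (Ioo 0 1) := fun x hx =>
      derivWithin_of_mem_nhds (Icc_mem_nhds hx.1 hx.2)
    have hdd : ContDiffOn ℝ 1 (deriv u) (Ioo 0 1) :=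
      ((contDiffOn_succ_iff_deriv_of_isOpen (n := 1) isOpen_Ioo).1 (by rw [one_add_one_eq_two]; exact h2)).2.2
    have hdv : DifferentiableOn ℝ (derivWithin u (Icc 0 1)) (Ioo 0 1) :=
      (hdd.differentiableOn (by norm_num)).congr heq
    have hv := (hdv r hr).hasDerivWithinAt.hasDerivAt (Ioo_mem_nhds hr.1 hr.2)
    have ho := hode r hr
    have hm := mu_deriv D α r
    have := (((hasDerivAt_id r).mul hm).mul hv).neg
    refine this.congr_deriv ?_
    rw [psiE_eq D (Ioo_subset_Icc_self hr), ← ho, phiE_eq D (Ioo_subset_Icc_self hr)]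
    have : r ≠ 0 := hr.1.ne'
    simp only [id, Pi.mul_apply]
    field_simp
    ring

lemma sol_ineq (D : GelfandData) {α lam : ℝ} (hα : 0 < α) (hl : 0 ≤ lam) {u : ℝ → ℝ}
    (h : IsSolution D α lam u) :
    AntitoneOn u (Icc 0 1) ∧ ∃ v : ℝ → ℝ, (∀ r ∈ Ioo (0:ℝ) 1, HasDerivAt u (v r) r) ∧
      ∀ s ∈ Ioo (0:ℝ) 1, lam * psiE D s * D.f (u s) * (mu D α s - 1) / α
        ≤ -(s * mu D α s * v s) := by
  obtain ⟨v, hvc, hv, hP⟩ := sol_basic D h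
  obtain ⟨h1, h2, hpos, hd0, hu1, hode⟩ := h
  have hPc : ContinuousOn (fun r => -(r * mu D α r * v r)) (Icc 0 1) :=
    ((continuousOn_id.mul (mu_cont D α).continuousOn).mul hvc).neg
  have hun : ∀ r ∈ Icc (0:ℝ) 1, 0 ≤ u r := by
    intro r hr
    rcases hr.2.eq_or_lt with h | h
    · rw [h, hu1]
    · exact (hpos r ⟨hr.1, h⟩).le
  have hPm : MonotoneOn (fun r => -(r * mu D α r * v r)) (Icc 0 1) := by
    apply monotoneOn_of_deriv_nonneg (convex_Icc 0 1) hPc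
    · intro x hx
      rw [interior_Icc] at hx
      exact (hP x hx).differentiableAt.differentiableWithinAt
    · intro x hx
      rw [interior_Icc] at hx
      rw [(hP x hx).deriv]
      have := psiE_nonneg D x
      have := mu_pos D α x
      have := D.f_pos _ (hun x (Ioo_subset_Icc_self hx))
      have := hx.1
      positivity
  have hvn : ∀ r ∈ Ioo (0:ℝ) 1, v r ≤ 0 := by
    intro r hr
    have h0 := hPm (left_mem_Icc.2 zero_le_one) (Ioo_subset_Icc_self hr) hr.1.le
    simp only [zero_mul, neg_zero] at h0
    by_contra hc
    push Not at hc
    have : 0 < r * mu D α r * v r := mul_pos (mul_pos hr.1 (mu_pos D α r)) hc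
    linarith
  have hua : AntitoneOn u (Icc 0 1) := by
    apply antitoneOn_of_deriv_nonpos (convex_Icc 0 1) h1.continuousOn
    · intro x hx
      rw [interior_Icc] at hx
      exact (hv x hx).differentiableAt.differentiableWithinAt
    · intro x hx
      rw [interior_Icc] at hx
      rw [(hv x hx).deriv]
      exact hvn x hx
  refine ⟨hua, v, hv, ?_⟩
  intro s hs
  set B := lam * psiE D s * D.f (u s) with hB
  have hB0 : 0 ≤ B := by
    have := psiE_nonneg D s
    have := D.f_pos _ (hun s (Ioo_subset_Icc_self hs))
    positivity
  have hder : ∀ x ∈ Ioo (0:ℝ) s, HasDerivAt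
      (fun r => -(r * mu D α r * v r) - B * (mu D α r - 1) / α)
      (x * mu D α x * (lam * psiE D x * D.f (u x)) -
        B * (α * (x * phiE D x) * mu D α x) / α) x := by
    intro x hx
    exact (hP x ⟨hx.1, hx.2.trans hs.2⟩).sub
      ((((mu_deriv D α x).sub_const 1).const_mul B).div_const α)
  have hm : MonotoneOn (fun r => -(r * mu D α r * v r) - B * (mu D α r - 1) / α) (Icc 0 s) := by
    apply monotoneOn_of_deriv_nonneg (convex_Icc 0 s)
    · apply (hPc.mono (Icc_subset_Icc_right hs.2.le)).sub
      have := mu_cont D α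
      exact Continuous.continuousOn (by fun_prop)
    · intro x hx
      rw [interior_Icc] at hx
      exact (hder x hx).differentiableAt.differentiableWithinAt
    · intro x hx
      rw [interior_Icc] at hx
      rw [(hder x hx).deriv]
      have hx1 : x ∈ Icc (0:ℝ) 1 := ⟨hx.1.le, (hx.2.trans hs.2).le⟩
      have e1 : psiE D s ≤ psiE D x := psiE_anti D hx.2.le
      have e2 : D.f (u s) ≤ D.f (u x) :=
        D.f_mono (hun s (Ioo_subset_Icc_self hs)) (hun x hx1) (hua hx1 (Ioo_subset_Icc_self hs) hx.2.le)
      have e3 : B ≤ lam * psiE D x * D.f (u x) := by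
        rw [hB]
        have := psiE_nonneg D s
        have := D.f_pos _ (hun s (Ioo_subset_Icc_self hs))
        gcongr
        exact mul_nonneg hl (psiE_nonneg D x)
      have e4 := phiE_le_one D x
      have e5 : 0 ≤ x * mu D α x := (mul_pos hx.1 (mu_pos D α x)).le
      have e6 : B * (α * (x * phiE D x) * mu D α x) / α = (x * mu D α x) * (B * phiE D x) := by
        field_simp
      rw [e6, ← mul_sub]
      apply mul_nonneg e5
      nlinarith
  have := hm (left_mem_Icc.2 hs.1.le) (right_mem_Icc.2 hs.1.le) hs.1.le
  simp only [zero_mul, mu_zero] at this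
  simp at this
  linarith

lemma not_sol_zero (D : GelfandData) {α : ℝ} {u : ℝ → ℝ}
    (h : IsSolution D α 0 u) : False := by
  obtain ⟨v, hvc, hv, hP⟩ := sol_basic D h
  obtain ⟨h1, h2, hpos, hd0, hu1, hode⟩ := h
  have hPc : ContinuousOn (fun r => -(r * mu D α r * v r)) (Icc 0 1) :=
    ((continuousOn_id.mul (mu_cont D α).continuousOn).mul hvc).neg
  have hPm : AntitoneOn (fun r => -(r * mu D α r * v r)) (Icc 0 1) := by
    apply antitoneOn_of_deriv_nonpos (convex_Icc 0 1) hPc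
    · intro x hx
      rw [interior_Icc] at hx
      exact (hP x hx).differentiableAt.differentiableWithinAt
    · intro x hx
      rw [interior_Icc] at hx
      rw [(hP x hx).deriv]
      simp
  have hvn : ∀ r ∈ Ioo (0:ℝ) 1, 0 ≤ v r := by
    intro r hr
    have h0 := hPm (left_mem_Icc.2 zero_le_one) (Ioo_subset_Icc_self hr) hr.1.le
    simp only [zero_mul, neg_zero] at h0
    by_contra hc
    push Not at hc
    have : r * mu D α r * v r < 0 := mul_neg_of_pos_of_neg (mul_pos hr.1 (mu_pos D α r)) hc
    linarith
  have hua : MonotoneOn u (Icc 0 1) := by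
    apply monotoneOn_of_deriv_nonneg (convex_Icc 0 1) h1.continuousOn
    · intro x hx
      rw [interior_Icc] at hx
      exact (hv x hx).differentiableAt.differentiableWithinAt
    · intro x hx
      rw [interior_Icc] at hx
      rw [(hv x hx).deriv]
      exact hvn x hx
  have := hua (left_mem_Icc.2 zero_le_one) (right_mem_Icc.2 zero_le_one) zero_le_one
  have := hpos 0 (by simp)
  linarith

lemma sol_upper (D : GelfandData) {α lam : ℝ} (hα : 0 < α) (hl : 0 ≤ lam) {u : ℝ → ℝ}
    (h : IsSolution D α lam u) {N : ℝ} (huN : u 0 ≤ N) {a b ε : ℝ} (ha : 0 < a) (hab : a < b)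
    (hb : b < 1) (hε : 0 < ε) (hε1 : ε < 1) (hψ : 1 - ε ≤ psiE D b) (hμ : 1 / ε ≤ mu D α a) :
    lam / α * (1 - ε) ^ 2 * Real.log (b / a) ≤ FE D N (u 0) := by
  obtain ⟨hua, v, hv, hineq⟩ := sol_ineq D hα hl h
  obtain ⟨h1, h2, hpos, hd0, hu1, hode⟩ := h
  have hm : AntitoneOn (fun s => FE D N (u s) + lam / α * (1 - ε) ^ 2 * Real.log s) (Icc a b) := by
    have hder : ∀ x ∈ Icc a b, HasDerivAt
        (fun s => FE D N (u s) + lam / α * (1 - ε) ^ 2 * Real.log s)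
        (1 / fE D N (u x) * v x + lam / α * (1 - ε) ^ 2 * x⁻¹) x := by
      intro x hx
      have hx0 : 0 < x := ha.trans_le hx.1
      exact ((FE_deriv D N (u x)).comp x (hv x ⟨hx0, hx.2.trans_lt hb⟩)).add
        ((Real.hasDerivAt_log hx0.ne').const_mul _)
    apply antitoneOn_of_deriv_nonpos (convex_Icc a b)
    · intro x hx; exact (hder x hx).continuousAt.continuousWithinAt
    · intro x hx
      rw [interior_Icc] at hx
      exact (hder x (Ioo_subset_Icc_self hx)).differentiableAt.differentiableWithinAt
    · intro x hx
      rw [interior_Icc] at hx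
      rw [(hder x (Ioo_subset_Icc_self hx)).deriv]
      have hx0 : 0 < x := ha.trans hx.1
      have hxI : x ∈ Ioo (0:ℝ) 1 := ⟨hx0, hx.2.trans hb⟩
      have hux : 0 < u x := hpos x ⟨hx0.le, hxI.2⟩
      have huN' : u x ≤ N := (hua (by simp) (Ioo_subset_Icc_self hxI) hx0.le).trans huN
      rw [fE_of_mem D ⟨hux.le, huN'⟩]
      have hf := D.f_pos _ hux.le
      have hi := hineq x hxI
      have hmux : 1 / ε ≤ mu D α x := hμ.trans (mu_mono D hα.le (mem_Ici.2 ha.le) (mem_Ici.2 hx0.le) hx.1.le)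
      have hps : 1 - ε ≤ psiE D x := hψ.trans (psiE_anti D hx.2.le)
      have hmp := mu_pos D α x
      have h3 : (1 - ε) * mu D α x ≤ mu D α x - 1 := by
        rw [div_le_iff₀ hε] at hmux
        nlinarith
      have h4 : lam * (1 - ε) * D.f (u x) * ((1 - ε) * mu D α x) / α
          ≤ -(x * mu D α x * v x) := by
        refine le_trans ?_ hi
        have : 0 ≤ 1 - ε := by linarith
        gcongr
        exact mul_nonneg (mul_nonneg hl (psiE_nonneg D x)) hf.le
      have h5 : (1 / D.f (u x) * v x + lam / α * (1 - ε) ^ 2 * x⁻¹) =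
        (x * mu D α x * v x + lam * (1 - ε) * D.f (u x) * ((1 - ε) * mu D α x) / α) /
          (D.f (u x) * x * mu D α x) := by
        field_simp
      rw [h5]
      apply div_nonpos_of_nonpos_of_nonneg
      · linarith
      · positivity
  have h3 := hm (left_mem_Icc.2 hab.le) (right_mem_Icc.2 hab.le) hab.le
  simp only at h3
  have h4 : FE D N (u a) ≤ FE D N (u 0) := (FE_strictMono D N).monotone
    (hua (by simp) ⟨ha.le, (hab.trans hb).le⟩ ha.le)
  have h5 : 0 ≤ FE D N (u b) := by
    rw [← FE_zero D N]
    exact (FE_strictMono D N).monotone (hpos b ⟨(ha.trans hab).le, hb⟩).le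
  rw [Real.log_div (ha.trans hab).ne' ha.ne', mul_sub]
  linarith

lemma mu_lower (D : GelfandData) {α a : ℝ} (hα : 0 < α) (ha : 0 < a) (hφ : 1 / 2 ≤ phiE D a) :
    α * a ^ 2 / 4 ≤ mu D α a := by
  have hc : Continuous (fun s => s * phiE D s) := continuous_id.mul (phiE_cont D)
  have h1 : ∫ s in (0:ℝ)..a, s * (1 / 2) ≤ ∫ s in (0:ℝ)..a, s * phiE D s := by
    apply intervalIntegral.integral_mono_on ha.le
      (Continuous.intervalIntegrable (by fun_prop) _ _) (hc.intervalIntegrable _ _)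
    intro x hx
    have := hφ.trans (phiE_anti D hx.2)
    exact mul_le_mul_of_nonneg_left this hx.1
  have h2 : ∫ s in (0:ℝ)..a, s * (1 / 2 : ℝ) = a ^ 2 / 4 := by
    rw [intervalIntegral.integral_mul_const, integral_id]; ring
  rw [h2] at h1
  unfold mu
  have h3 := Real.add_one_le_exp (α * ∫ s in (0:ℝ)..a, s * phiE D s)
  have h4 : α * (a ^ 2 / 4) ≤ α * ∫ s in (0:ℝ)..a, s * phiE D s := by gcongr
  linarith


noncomputable def Sop (D : GelfandData) (α N : ℝ) (v : ℝ → ℝ) (s : ℝ) : ℝ :=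
  ∫ t in (0:ℝ)..s, psiE D t * (mu D α t * t) * fE D N (v t)
noncomputable def gop (D : GelfandData) (α N : ℝ) (v : ℝ → ℝ) (s : ℝ) : ℝ :=
  Sop D α N v s / (s * mu D α s)
noncomputable def Tmap (D : GelfandData) (α N lam : ℝ) (v : ℝ → ℝ) (r : ℝ) : ℝ :=
  ∫ s in (cl r)..1, lam * gop D α N v s

lemma Sint (D : GelfandData) (α N : ℝ) {v : ℝ → ℝ} (hv : Antitone v) (a b : ℝ) :
    IntervalIntegrable (fun t => psiE D t * (mu D α t * t) * fE D N (v t)) volume a b := by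
  have h1 : Antitone (fun t => fE D N (v t)) := fun x y h => fE_mono D N (hv h)
  have h2 : Continuous (fun t => psiE D t * (mu D α t * t)) :=
    (psiE_cont D).mul ((mu_cont D α).mul continuous_id)
  exact h1.intervalIntegrable.continuousOn_mul h2.continuousOn

lemma S_nonneg (D : GelfandData) (α N : ℝ) (v : ℝ → ℝ) {s : ℝ} (hs : 0 ≤ s) :
    0 ≤ Sop D α N v s := by
  apply intervalIntegral.integral_nonneg hs
  intro t ht
  have := psiE_nonneg D t
  have := mu_pos D α t
  have := fE_pos D N (v t)
  have := ht.1
  positivity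

lemma S_le (D : GelfandData) {α N : ℝ} (hα : 0 ≤ α) {v : ℝ → ℝ} (hv : Antitone v) {s C : ℝ}
    (hs : 0 ≤ s) (hC : ∀ t ∈ Icc 0 s, fE D N (v t) ≤ C) :
    Sop D α N v s ≤ C * mu D α s * s ^ 2 := by
  have h : Sop D α N v s ≤ ∫ t in (0:ℝ)..s, C * mu D α s * s := by
    apply intervalIntegral.integral_mono_on hs (Sint D α N hv _ _) (by simp)
    intro t ht
    have h1 := psiE_nonneg D t
    have h1' := psiE_le_one D t
    have h2 := mu_pos D α t
    have h2' : mu D α t ≤ mu D α s := mu_mono D hα (mem_Ici.2 ht.1) (mem_Ici.2 hs) ht.2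
    have h3 := fE_pos D N (v t)
    have h4 := hC t ht
    calc psiE D t * (mu D α t * t) * fE D N (v t) ≤ 1 * (mu D α s * s) * C := by
          have h5 : mu D α t * t ≤ mu D α s * s :=
            mul_le_mul h2' ht.2 ht.1 (h2.le.trans h2')
          have h6 : 0 ≤ mu D α t * t := mul_nonneg h2.le ht.1
          gcongr
          exact mul_nonneg zero_le_one (h6.trans h5)
      _ = _ := by ring
  refine h.trans (le_of_eq ?_)
  rw [intervalIntegral.integral_const, smul_eq_mul]; ring

lemma S_cont (D : GelfandData) (α N : ℝ) {v : ℝ → ℝ} (hv : Antitone v) :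
    Continuous (Sop D α N v) :=
  intervalIntegral.continuous_primitive (fun a b => Sint D α N hv a b) 0

lemma S_mono (D : GelfandData) (α N : ℝ) {v w : ℝ → ℝ} (hv : Antitone v) (hw : Antitone w)
    (h : ∀ r, v r ≤ w r) {s : ℝ} (hs : 0 ≤ s) : Sop D α N v s ≤ Sop D α N w s := by
  apply intervalIntegral.integral_mono_on hs (Sint D α N hv _ _) (Sint D α N hw _ _)
  intro t ht
  have h3 := fE_mono D N (h t)
  exact mul_le_mul_of_nonneg_left h3
    (mul_nonneg (psiE_nonneg D t) (mul_nonneg (mu_pos D α t).le ht.1))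

lemma g_nonneg (D : GelfandData) (α N : ℝ) (v : ℝ → ℝ) {s : ℝ} (hs : 0 ≤ s) :
    0 ≤ gop D α N v s :=
  div_nonneg (S_nonneg D α N v hs) (mul_nonneg hs (mu_pos D α s).le)

lemma g_le (D : GelfandData) {α N : ℝ} (hα : 0 ≤ α) {v : ℝ → ℝ} (hv : Antitone v) {s C : ℝ}
    (hs : 0 ≤ s) (hC : ∀ t ∈ Icc 0 s, fE D N (v t) ≤ C) :
    gop D α N v s ≤ C * s := by
  rcases hs.eq_or_lt with h | h
  · simp [gop, ← h]
  · unfold gop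
    rw [div_le_iff₀ (mul_pos h (mu_pos D α s))]
    have := S_le D hα hv hs hC
    nlinarith

lemma g_cont (D : GelfandData) {α N : ℝ} (hα : 0 ≤ α) (hN : 0 ≤ N) {v : ℝ → ℝ} (hv : Antitone v) :
    ContinuousOn (gop D α N v) (Ici 0) := by
  intro s hs
  rcases (mem_Ici.1 hs).eq_or_lt with h | h
  · rw [← h]
    have h0 : gop D α N v 0 = 0 := by simp [gop]
    unfold ContinuousWithinAt
    rw [h0]
    have hlim : Tendsto (fun s : ℝ => D.f N * s) (nhdsWithin 0 (Ici 0)) (nhds 0) := by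
      have : Continuous (fun s : ℝ => D.f N * s) := by fun_prop
      have := this.tendsto 0
      simp only [mul_zero] at this
      exact this.mono_left nhdsWithin_le_nhds
    refine tendsto_of_tendsto_of_tendsto_of_le_of_le' tendsto_const_nhds hlim ?_ ?_
    · filter_upwards [self_mem_nhdsWithin] with x hx using g_nonneg D α N v hx
    · filter_upwards [self_mem_nhdsWithin] with x hx
      exact g_le D hα hv hx (fun t _ => fE_le D hN _)
  · apply ContinuousAt.continuousWithinAt
    exact (S_cont D α N hv).continuousAt.div (continuous_id.mul (mu_cont D α)).continuousAt
      (mul_pos h (mu_pos D α s)).ne'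

lemma g_int (D : GelfandData) {α N : ℝ} (hα : 0 ≤ α) (hN : 0 ≤ N) {v : ℝ → ℝ} (hv : Antitone v)
    (lam : ℝ) {a b : ℝ} (ha : 0 ≤ a) (hb : 0 ≤ b) :
    IntervalIntegrable (fun s => lam * gop D α N v s) volume a b := by
  apply ContinuousOn.intervalIntegrable
  apply continuousOn_const.mul
  apply (g_cont D hα hN hv).mono
  intro x hx
  exact (le_min ha hb).trans hx.1

lemma T_anti (D : GelfandData) {α N lam : ℝ} (hα : 0 ≤ α) (hN : 0 ≤ N) (hl : 0 ≤ lam)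
    {v : ℝ → ℝ} (hv : Antitone v) : Antitone (Tmap D α N lam v) := by
  intro a b hab
  have h := cl_mono hab
  have hi : ∫ s in (cl a)..1, lam * gop D α N v s = (∫ s in (cl a)..(cl b), lam * gop D α N v s)
      + ∫ s in (cl b)..1, lam * gop D α N v s :=
    (intervalIntegral.integral_add_adjacent_intervals
      (g_int D hα hN hv lam (cl_mem a).1 (cl_mem b).1)
      (g_int D hα hN hv lam (cl_mem b).1 zero_le_one)).symm
  have : 0 ≤ ∫ s in (cl a)..(cl b), lam * gop D α N v s :=
    intervalIntegral.integral_nonneg h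
      (fun x hx => mul_nonneg hl (g_nonneg D α N v ((cl_mem a).1.trans hx.1)))
  unfold Tmap
  linarith

lemma T_nonneg (D : GelfandData) {α N lam : ℝ} (hl : 0 ≤ lam)
    (v : ℝ → ℝ) (r : ℝ) : 0 ≤ Tmap D α N lam v r :=
  intervalIntegral.integral_nonneg (cl_mem r).2
      (fun x hx => mul_nonneg hl (g_nonneg D α N v ((cl_mem r).1.trans hx.1)))

lemma T_mono (D : GelfandData) {α N lam : ℝ} (hα : 0 ≤ α) (hN : 0 ≤ N) (hl : 0 ≤ lam)
    {v w : ℝ → ℝ} (hv : Antitone v) (hw : Antitone w) (h : ∀ r, v r ≤ w r) (r : ℝ) :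
    Tmap D α N lam v r ≤ Tmap D α N lam w r := by
  apply intervalIntegral.integral_mono_on (cl_mem r).2
    (g_int D hα hN hv lam (cl_mem r).1 zero_le_one) (g_int D hα hN hw lam (cl_mem r).1 zero_le_one)
  intro x hx
  have hx0 := (cl_mem r).1.trans hx.1
  exact mul_le_mul_of_nonneg_left (div_le_div_of_nonneg_right (S_mono D α N hv hw h hx0)
    (mul_nonneg hx0 (mu_pos D α x).le)) hl

lemma exists_fixed (D : GelfandData) {α N lam : ℝ} (hα : 0 ≤ α) (hN : 0 ≤ N) (hl : 0 ≤ lam)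
    {w : ℝ → ℝ} (hw : Antitone w) (hw0 : ∀ r, 0 ≤ w r) (hT : ∀ r, Tmap D α N lam w r ≤ w r) :
    ∃ u : ℝ → ℝ, Antitone u ∧ (∀ r, u r ≤ w r) ∧ ∀ r, Tmap D α N lam u r = u r := by
  let A : Set (ℝ → ℝ) := {v | Antitone v ∧ (∀ r, 0 ≤ v r) ∧ ∀ r, Tmap D α N lam v r ≤ v r}
  have hwA : w ∈ A := ⟨hw, hw0, hT⟩
  have : Nonempty A := ⟨⟨w, hwA⟩⟩
  let u : ℝ → ℝ := fun r => ⨅ v : A, v.1 r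
  have hbd : ∀ r, BddBelow (range fun v : A => v.1 r) := by
    intro r; refine ⟨0, ?_⟩; rintro _ ⟨v, rfl⟩; exact v.2.2.1 r
  have hule : ∀ v ∈ A, ∀ r, u r ≤ v r := fun v hv r => ciInf_le (hbd r) (⟨v, hv⟩ : A)
  have hua : Antitone u := by
    intro a b hab
    exact le_ciInf fun v => (hule v.1 v.2 b).trans (v.2.1 hab)
  have hTu : ∀ r, Tmap D α N lam u r ≤ u r := by
    intro r
    exact le_ciInf fun v => (T_mono D hα hN hl hua v.2.1 (hule v.1 v.2) r).trans (v.2.2.2 r)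
  have hTA : Tmap D α N lam u ∈ A :=
    ⟨T_anti D hα hN hl hua, T_nonneg D hl u, T_mono D hα hN hl (T_anti D hα hN hl hua) hua hTu⟩
  exact ⟨u, hua, hule w hwA, fun r => le_antisymm (hTu r) (hule _ hTA r)⟩

lemma S_pos (D : GelfandData) {α N : ℝ} {v : ℝ → ℝ} (hv : Antitone v) (hvc : Continuous v)
    {s : ℝ} (hs : 0 < s) : 0 < Sop D α N v s := by
  have hc : Continuous (fun t => psiE D t * (mu D α t * t) * fE D N (v t)) :=
    ((psiE_cont D).mul ((mu_cont D α).mul continuous_id)).mul ((fE_cont D N).comp hvc)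
  apply intervalIntegral.integral_pos hs hc.continuousOn
  · intro t ht
    have := psiE_nonneg D t
    have := mu_pos D α t
    have := fE_pos D N (v t)
    have := ht.1
    positivity
  · have h1 : ∀ᶠ t in nhds (0:ℝ), 0 < psiE D t :=
      (psiE_cont D).continuousAt.eventually (lt_mem_nhds (by rw [psiE_zero]; exact one_pos))
    have h2 : ∀ᶠ t in nhdsWithin (0:ℝ) (Ioi 0), 0 < psiE D t := nhdsWithin_le_nhds h1
    obtain ⟨t, ht1, ht2⟩ := (h2.and (Ioo_mem_nhdsGT hs)).exists
    refine ⟨t, ⟨ht2.1.le, ht2.2.le⟩, ?_⟩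
    have := mu_pos D α t
    have := fE_pos D N (v t)
    have := ht2.1
    positivity

lemma exists_sol (D : GelfandData) {α N lam : ℝ} (hα : 0 ≤ α) (hN : 0 ≤ N) (hl : 0 < lam)
    {w : ℝ → ℝ} (hw : Antitone w) (hw0 : ∀ r, 0 ≤ w r) (hwN : ∀ r, w r ≤ N)
    (hT : ∀ r, Tmap D α N lam w r ≤ w r) : ∃ u, IsSolution D α lam u := by
  obtain ⟨u, hua, huw, hfix⟩ := exists_fixed D hα hN hl.le hw hw0 hT
  -- continuous extension of g
  let G : ℝ → ℝ := fun s => gop D α N u (cl s)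
  have hGc : Continuous G :=
    (g_cont D hα hN hua).comp_continuous cl_cont (fun x => (cl_mem x).1)
  let U : ℝ → ℝ := fun r => ∫ s in r..1, lam * G s
  have hUd : ∀ r, HasDerivAt U (-(lam * G r)) r := by
    intro r
    have hc : Continuous (fun s => lam * G s) := continuous_const.mul hGc
    exact intervalIntegral.integral_hasDerivAt_left (hc.intervalIntegrable _ _)
      hc.stronglyMeasurable.stronglyMeasurableAtFilter hc.continuousAt
  have hUc : Continuous U := continuous_iff_continuousAt.2 fun r => (hUd r).continuousAt
  have hu : ∀ r, u r = U (cl r) := by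
    intro r
    rw [← hfix r]
    apply intervalIntegral.integral_congr
    intro x hx
    rw [uIcc_of_le (cl_mem r).2] at hx
    simp only [G]
    rw [cl_of_mem ⟨(cl_mem r).1.trans hx.1, hx.2⟩]
  have huU : ∀ r ∈ Icc (0:ℝ) 1, U r = u r := fun r hr => by rw [hu r, cl_of_mem hr]
  have huc : Continuous u := by
    rw [show u = fun r => U (cl r) from funext hu]; exact hUc.comp cl_cont
  have hu0 : ∀ r, 0 ≤ u r := fun r => by rw [← hfix r]; exact T_nonneg D hl.le u r
  have hIc : Continuous (fun t => psiE D t * (mu D α t * t) * fE D N (u t)) :=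
    ((psiE_cont D).mul ((mu_cont D α).mul continuous_id)).mul ((fE_cont D N).comp huc)
  have hSd : ∀ s, HasDerivAt (Sop D α N u) (psiE D s * (mu D α s * s) * fE D N (u s)) s := by
    intro s
    exact intervalIntegral.integral_hasDerivAt_right (hIc.intervalIntegrable _ _)
      hIc.stronglyMeasurable.stronglyMeasurableAtFilter hIc.continuousAt
  have hSC : ContDiff ℝ 1 (Sop D α N u) := by
    rw [contDiff_one_iff_deriv]
    refine ⟨fun s => (hSd s).differentiableAt, ?_⟩
    rw [show deriv (Sop D α N u) = _ from funext fun s => (hSd s).deriv]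
    exact hIc
  have hmuC : ContDiff ℝ 1 (mu D α) := by
    rw [contDiff_one_iff_deriv]
    refine ⟨fun s => (mu_deriv D α s).differentiableAt, ?_⟩
    rw [show deriv (mu D α) = _ from funext fun s => (mu_deriv D α s).deriv]
    have := mu_cont D α
    have := phiE_cont D
    fun_prop
  have hUC : ContDiff ℝ 1 U := by
    rw [contDiff_one_iff_deriv]
    refine ⟨fun s => (hUd s).differentiableAt, ?_⟩
    rw [show deriv U = _ from funext fun s => (hUd s).deriv]
    exact (continuous_const.mul hGc).neg
  have hdW : ∀ r ∈ Icc (0:ℝ) 1, derivWithin U (Icc 0 1) r = -(lam * G r) := fun r hr =>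
    (hUd r).hasDerivWithinAt.derivWithin (uniqueDiffOn_Icc one_pos r hr)
  have hGg : ∀ r ∈ Icc (0:ℝ) 1, G r = Sop D α N u r / (r * mu D α r) := fun r hr => by
    simp only [G]; rw [cl_of_mem hr, gop]
  refine ⟨U, hUC.contDiffOn, ?_, ?_, ?_, ?_, ?_⟩
  · rw [← one_add_one_eq_two, contDiffOn_succ_iff_deriv_of_isOpen isOpen_Ioo]
    refine ⟨fun x _ => (hUd x).differentiableAt.differentiableWithinAt, by simp, ?_⟩
    have : ContDiffOn ℝ 1 (fun r => -(lam * (Sop D α N u r / (r * mu D α r)))) (Ioo 0 1) := by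
      apply ContDiffOn.neg
      apply contDiffOn_const.mul
      apply hSC.contDiffOn.div (contDiff_id.mul hmuC).contDiffOn
      intro x hx
      exact (mul_pos hx.1 (mu_pos D α x)).ne'
    apply this.congr
    intro x hx
    rw [(hUd x).deriv, hGg x (Ioo_subset_Icc_self hx)]
  · intro r hr
    apply intervalIntegral.integral_pos hr.2 (continuous_const.mul hGc).continuousOn
    · intro x hx
      exact mul_nonneg hl.le (g_nonneg D α N u (cl_mem x).1)
    · refine ⟨1, ⟨hr.2.le, le_rfl⟩, mul_pos hl ?_⟩
      rw [hGg 1 (by simp)]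
      exact div_pos (S_pos D hua huc one_pos) (mul_pos one_pos (mu_pos D α 1))
  · rw [hdW 0 (by simp), hGg 0 (by simp)]; simp
  · simp [U]
  · intro r hr
    have hrI := Ioo_subset_Icc_self hr
    have hr0 : r ≠ 0 := hr.1.ne'
    have hmr : mu D α r ≠ 0 := (mu_pos D α r).ne'
    have hd2 : HasDerivAt (fun r => -(lam * (Sop D α N u r / (r * mu D α r)))) _ r :=
      ((((hSd r).div ((hasDerivAt_id r).mul (mu_deriv D α r)) (mul_ne_zero hr0 hmr)).const_mul
        lam).neg)
    have hd3 := (hd2.hasDerivWithinAt (s := Ioo 0 1)).congr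
      (f₁ := derivWithin U (Icc 0 1))
      (fun x hx => by rw [hdW x (Ioo_subset_Icc_self hx), hGg x (Ioo_subset_Icc_self hx)])
      (by rw [hdW r hrI, hGg r hrI])
    rw [hd3.derivWithin (isOpen_Ioo.uniqueDiffWithinAt hr), hdW r hrI, hGg r hrI, huU r hrI,
      ← phiE_eq D hrI, ← psiE_eq D hrI, ← fE_of_mem D (N := N) ⟨hu0 r, (huw r).trans (hwN r)⟩]
    simp only [id, Pi.mul_apply]
    field_simp
    ring


lemma M_nonneg (D : GelfandData) {s : ℝ} (hs : s ∈ Ico (0:ℝ) 1) : 0 ≤ D.M s := by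
  have h := (D.M_def s hs).2 ⟨0, ⟨le_rfl, hs.1⟩, rfl⟩
  simp only [D.psi_zero, D.phi_zero] at h
  linarith

lemma psi_le_M (D : GelfandData) {s t : ℝ} (hs : s ∈ Ico (0:ℝ) 1) (ht : t ∈ Icc 0 s) :
    psiE D t ≤ D.M s * phiE D t := by
  have h := (D.M_def s hs).2 ⟨t, ht, rfl⟩
  have ht1 : t ∈ Icc (0:ℝ) 1 := ⟨ht.1, ht.2.trans hs.2.le⟩
  rw [psiE_eq D ht1, phiE_eq D ht1]
  exact (div_le_iff₀ (D.phi_pos t ⟨ht.1, ht.2.trans_lt hs.2⟩)).1 h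

lemma g_M (D : GelfandData) {α N : ℝ} (hα : 0 < α) (hN : 0 ≤ N) {v : ℝ → ℝ} (hv : Antitone v)
    {s : ℝ} (hs : s ∈ Ioo (0:ℝ) 1) : gop D α N v s ≤ D.f N * D.M s / (α * s) := by
  have hs' : s ∈ Ico (0:ℝ) 1 := ⟨hs.1.le, hs.2⟩
  have hfN := D.f_pos N hN
  have hM := M_nonneg D hs'
  have hc : Continuous (fun t => α * (t * phiE D t) * mu D α t) := by
    have := mu_cont D α
    have := phiE_cont D
    fun_prop
  have hftc : ∫ t in (0:ℝ)..s, α * (t * phiE D t) * mu D α t = mu D α s - 1 := by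
    rw [intervalIntegral.integral_eq_sub_of_hasDerivAt (fun x _ => mu_deriv D α x)
      (hc.intervalIntegrable _ _), mu_zero]
  have h1 : Sop D α N v s ≤ ∫ t in (0:ℝ)..s, D.f N * D.M s / α * (α * (t * phiE D t) * mu D α t) := by
    apply intervalIntegral.integral_mono_on hs.1.le (Sint D α N hv _ _)
      ((continuous_const.mul hc).intervalIntegrable _ _)
    intro t ht
    have e1 := psi_le_M D hs' ht
    have e2 := fE_le D hN (v t)
    have e3 := (fE_pos D N (v t)).le
    have e4 : 0 ≤ mu D α t * t := mul_nonneg (mu_pos D α t).le ht.1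
    have e5 := psiE_nonneg D t
    calc psiE D t * (mu D α t * t) * fE D N (v t)
        ≤ (D.M s * phiE D t) * (mu D α t * t) * D.f N := by
          have := e5.trans e1
          gcongr
      _ = D.f N * D.M s / α * (α * (t * phiE D t) * mu D α t) := by field_simp
  rw [intervalIntegral.integral_const_mul, hftc] at h1
  have hm := mu_pos D α s
  unfold gop
  rw [div_le_div_iff₀ (mul_pos hs.1 hm) (mul_pos hα hs.1)]
  have h2 : Sop D α N v s ≤ D.f N * D.M s / α * mu D α s := by
    refine h1.trans ?_
    have : 0 ≤ D.f N * D.M s / α := by positivity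
    nlinarith
  calc Sop D α N v s * (α * s) ≤ (D.f N * D.M s / α * mu D α s) * (α * s) := by
        have := hs.1
        gcongr
    _ = _ := by field_simp

lemma super_exists (D : GelfandData) {α N ρ s0 ε c η : ℝ} {W : ℝ → ℝ} (hα : 0 < α) (hN : 0 < N)
    (hWm : StrictMono W) (hWc : Continuous W) (hWr : ∀ x, W (FE D N x) = x)
    (hWd : ∀ y, HasDerivAt W (fE D N (W y)) y)
    (hρ1 : ρ < 1) (hs0 : 0 < s0) (hαs : α * s0 ^ 2 = 1) (hsρ : s0 < ρ)
    (hε : 0 < ε) (hε2 : ε < 1 / 2) (hφ : 1 - ε ≤ phiE D ρ) (hc : 0 < c) (hη : 0 < η)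
    (hB : η + c * Real.log (ρ / s0) < FE D N N) (hc1 : c * D.f (N + 1) ≤ ε)
    (hc2 : c * D.f N * (1 + (∫ s in (0:ℝ)..1, D.M s) / ρ) ≤ W η) :
    ∃ u, IsSolution D α ((1 - 2 * ε) * c * α) u := by
  have hρ : 0 < ρ := hs0.trans hsρ
  have hlam : 0 < (1 - 2 * ε) * c * α := mul_pos (mul_pos (by linarith) hc) hα
  set lam := (1 - 2 * ε) * c * α with hlamdef
  have hW0 : W 0 = 0 := by have := hWr 0; rwa [FE_zero] at this
  have hWη : 0 < W η := by rw [← hW0]; exact hWm hη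
  let k : ℝ → ℝ := fun r => max s0 (min r ρ)
  have hk1 : ∀ r, s0 ≤ k r := fun r => le_max_left _ _
  have hk0 : ∀ r, 0 < k r := fun r => hs0.trans_le (hk1 r)
  have hk2 : ∀ r, k r ≤ ρ := fun r => max_le hsρ.le (min_le_right _ _)
  have hkm : Monotone k := fun a b h => by simp only [k]; gcongr
  have hkc : Continuous k := by simp only [k]; fun_prop
  have hkid : ∀ r ∈ Icc s0 ρ, k r = r := fun r hr => by
    simp only [k]; rw [min_eq_left hr.2, max_eq_right hr.1]
  let w1 : ℝ → ℝ := fun r => W (η + c * Real.log (ρ / r))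
  let w : ℝ → ℝ := fun r => w1 (k r)
  have hw1anti : ∀ a b, 0 < a → a ≤ b → w1 b ≤ w1 a := by
    intro a b ha hab
    apply hWm.monotone
    have hb := ha.trans_le hab
    have : Real.log (ρ / b) ≤ Real.log (ρ / a) := by
      apply Real.log_le_log (div_pos hρ hb); gcongr
    gcongr
  have hwa : Antitone w := fun a b h => hw1anti _ _ (hk0 a) (hkm h)
  have hw1ρ : w1 ρ = W η := by simp [w1, div_self hρ.ne']
  have hwη : ∀ r, W η ≤ w r := fun r => by
    rw [← hw1ρ]; exact hw1anti _ _ (hk0 r) (hk2 r)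
  have hw1N : w1 s0 < N := by
    have := hWm hB; rwa [hWr] at this
  have hwN : ∀ r, w r < N := fun r => (hw1anti _ _ hs0 (hk1 r)).trans_lt hw1N
  have hwc : Continuous w := by
    apply hWc.comp
    apply continuous_const.add
    apply continuous_const.mul
    apply Continuous.log
    · exact continuous_const.div hkc (fun r => (hk0 r).ne')
    · intro r; exact (div_pos hρ (hk0 r)).ne'
  have hweq : ∀ r ∈ Icc s0 ρ, w r = w1 r := fun r hr => by simp only [w]; rw [hkid r hr]
  have hw1d : ∀ s, 0 < s → HasDerivAt w1 (fE D N (w1 s) * (c * (-s⁻¹))) s := by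
    intro s hs
    have h1 : HasDerivAt (fun r => η + c * Real.log (ρ / r)) (c * (-s⁻¹)) s := by
      have h2 : HasDerivAt (fun r => η + c * (Real.log ρ - Real.log r)) (c * (-s⁻¹)) s :=
        (((Real.hasDerivAt_log hs.ne').const_sub _).const_mul c).const_add η
      refine h2.congr_of_eventuallyEq ?_
      filter_upwards [lt_mem_nhds hs] with x hx
      rw [Real.log_div hρ.ne' hx.ne']
    exact (hWd _).comp s h1
  have hIc : Continuous (fun t => psiE D t * (mu D α t * t) * fE D N (w t)) :=
    ((psiE_cont D).mul ((mu_cont D α).mul continuous_id)).mul ((fE_cont D N).comp hwc)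
  have hSd : ∀ s, HasDerivAt (Sop D α N w) (psiE D s * (mu D α s * s) * fE D N (w s)) s := by
    intro s
    exact intervalIntegral.integral_hasDerivAt_right (hIc.intervalIntegrable _ _)
      hIc.stronglyMeasurable.stronglyMeasurableAtFilter hIc.continuousAt
  -- the middle estimate
  have hmid : ∀ s ∈ Icc s0 ρ, (1 - 2 * ε) * α * Sop D α N w s ≤ fE D N (w1 s) * mu D α s := by
    have hder : ∀ x ∈ Icc s0 ρ, ∃ d, d ≤ D.f (N + 1) ∧ HasDerivAt
        (fun s => fE D N (w1 s) * mu D α s - (1 - 2 * ε) * α * Sop D α N w s)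
        (d * (fE D N (w1 x) * (c * (-x⁻¹))) * mu D α x +
          fE D N (w1 x) * (α * (x * phiE D x) * mu D α x) -
          (1 - 2 * ε) * α * (psiE D x * (mu D α x * x) * fE D N (w x))) x := by
      intro x hx
      have hx0 : 0 < x := hs0.trans_le hx.1
      have e1 : 0 < w1 x := by rw [← hweq x hx]; exact hWη.trans_le (hwη x)
      have e2 : w1 x < N := by rw [← hweq x hx]; exact hwN x
      obtain ⟨d, hd, hd2⟩ := fE_deriv_bound D e1 e2
      refine ⟨d, hd2, ?_⟩
      have e3 := hd.comp x (hw1d x hx0)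
      exact (e3.mul (mu_deriv D α x)).sub ((hSd x).const_mul _)
    have hmono : MonotoneOn
        (fun s => fE D N (w1 s) * mu D α s - (1 - 2 * ε) * α * Sop D α N w s) (Icc s0 ρ) := by
      apply monotoneOn_of_deriv_nonneg (convex_Icc s0 ρ)
      · intro x hx
        obtain ⟨d, _, hd⟩ := hder x hx
        exact hd.continuousAt.continuousWithinAt
      · intro x hx
        obtain ⟨d, _, hd⟩ := hder x (interior_subset hx)
        exact hd.differentiableAt.differentiableWithinAt
      · intro x hx
        have hxI := interior_subset hx
        obtain ⟨d, hdN, hd⟩ := hder x hxI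
        rw [hd.deriv, hweq x hxI]
        have hx0 : 0 < x := hs0.trans_le hxI.1
        have e1 := fE_pos D N (w1 x)
        have e2 := mu_pos D α x
        have e3 : 1 - ε ≤ phiE D x := hφ.trans (phiE_anti D hxI.2)
        have e4 := psiE_le_one D x
        have e5 : d * (fE D N (w1 x) * (c * (-x⁻¹))) * mu D α x +
          fE D N (w1 x) * (α * (x * phiE D x) * mu D α x) -
          (1 - 2 * ε) * α * (psiE D x * (mu D α x * x) * fE D N (w1 x)) =
          fE D N (w1 x) * mu D α x / x *
            (α * x ^ 2 * (phiE D x - (1 - 2 * ε) * psiE D x) - c * d) := by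
          field_simp
          ring
        rw [e5]
        apply mul_nonneg (by positivity)
        have e6 : c * d ≤ ε := (mul_le_mul_of_nonneg_left hdN hc.le).trans hc1
        have e7 : 1 ≤ α * x ^ 2 := by
          rw [← hαs]
          have := hxI.1
          gcongr
        have e8 : ε ≤ phiE D x - (1 - 2 * ε) * psiE D x := by nlinarith
        nlinarith
    intro s hs
    have h1 := hmono (left_mem_Icc.2 hsρ.le) hs hs.1
    simp only at h1
    have h2 : Sop D α N w s0 ≤ fE D N (w1 s0) * mu D α s0 * s0 ^ 2 := by
      apply S_le D hα.le hwa hs0.le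
      intro t ht
      apply fE_mono D N
      exact hw1anti _ _ hs0 (hk1 t)
    have h3 := mu_pos D α s0
    have h4 := fE_pos D N (w1 s0)
    have h5 : (1 - 2 * ε) * α * Sop D α N w s0 ≤ fE D N (w1 s0) * mu D α s0 := by
      calc (1 - 2 * ε) * α * Sop D α N w s0
          ≤ (1 - 2 * ε) * α * (fE D N (w1 s0) * mu D α s0 * s0 ^ 2) := by
            have : 0 ≤ (1 - 2 * ε) * α := mul_nonneg (by linarith) hα.le
            gcongr
        _ = (1 - 2 * ε) * (fE D N (w1 s0) * mu D α s0) * (α * s0 ^ 2) := by ring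
        _ ≤ _ := by rw [hαs]; nlinarith [mul_pos h4 h3]
    linarith
  -- E
  have hfN := D.f_pos N hN.le
  have hgi : ∀ a b, 0 ≤ a → 0 ≤ b →
      IntervalIntegrable (fun s => lam * gop D α N w s) volume a b :=
    fun a b ha hb => g_int D hα.le hN.le hwa lam ha hb
  have hadj : ∀ a b, 0 ≤ a → 0 ≤ b → ∫ s in a..1, lam * gop D α N w s =
      (∫ s in a..b, lam * gop D α N w s) + ∫ s in b..1, lam * gop D α N w s := fun a b ha hb =>
    (intervalIntegral.integral_add_adjacent_intervals (hgi a b ha hb)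
      (hgi b 1 hb zero_le_one)).symm
  have hMi : ∀ a b, 0 ≤ a → a ≤ b → b ≤ 1 → IntervalIntegrable D.M volume a b := by
    intro a b ha hab hb
    rw [intervalIntegrable_iff_integrableOn_Ioo_of_le hab]
    exact D.M_int.mono_set (Ioo_subset_Ioo ha hb)
  have hlamc : lam ≤ c * α := by rw [hlamdef]; nlinarith [mul_pos hc hα, mul_pos hε (mul_pos hc hα)]
  have hEρ : ∫ s in ρ..1, lam * gop D α N w s ≤
      c * D.f N * ((∫ s in (0:ℝ)..1, D.M s) / ρ) := by
    have h1 : ∫ s in ρ..1, lam * gop D α N w s ≤ ∫ s in ρ..1, c * D.f N / ρ * D.M s := by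
      apply intervalIntegral.integral_mono_on_of_le_Ioo hρ1.le (hgi ρ 1 hρ.le zero_le_one)
        ((hMi ρ 1 hρ.le hρ1.le le_rfl).const_mul _)
      intro x hx
      have hx0 := hρ.trans hx.1
      have h2 := g_M D hα hN.le hwa ⟨hx0, hx.2⟩
      have hM := M_nonneg D ⟨hx0.le, hx.2⟩
      calc lam * gop D α N w x ≤ (c * α) * (D.f N * D.M x / (α * x)) := by
            have := g_nonneg D α N w hx0.le
            gcongr
        _ = c * D.f N * D.M x / x := by field_simp
        _ ≤ c * D.f N * D.M x / ρ := by
            have := hx.1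
            gcongr
        _ = _ := by ring
    have h3 : ∫ s in ρ..1, D.M s ≤ ∫ s in (0:ℝ)..1, D.M s := by
      rw [← intervalIntegral.integral_add_adjacent_intervals (hMi 0 ρ le_rfl hρ.le hρ1.le)
        (hMi ρ 1 hρ.le hρ1.le le_rfl)]
      have : 0 ≤ ∫ s in (0:ℝ)..ρ, D.M s := intervalIntegral.integral_nonneg hρ.le
        (fun x hx => M_nonneg D ⟨hx.1, hx.2.trans_lt hρ1⟩)
      linarith
    rw [intervalIntegral.integral_const_mul (c * D.f N / ρ)] at h1
    refine h1.trans ?_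
    calc c * D.f N / ρ * ∫ s in ρ..1, D.M s ≤ c * D.f N / ρ * ∫ s in (0:ℝ)..1, D.M s := by
          gcongr
      _ = _ := by ring
  have hEmid : ∀ r ∈ Icc s0 ρ, ∫ s in r..ρ, lam * gop D α N w s ≤ w1 r - W η := by
    intro r hr
    have hr0 : 0 < r := hs0.trans_le hr.1
    have hfc : ContinuousOn (fun s => fE D N (w1 s) * (c * (-s⁻¹))) (Icc r ρ) := by
      intro s hs
      have hs' : 0 < s := hr0.trans_le hs.1
      apply ContinuousAt.continuousWithinAt
      exact ((fE_cont D N).continuousAt.comp (hw1d s hs').continuousAt).mul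
        (continuousAt_const.mul (continuousAt_inv₀ hs'.ne').neg)
    have hfi : IntervalIntegrable (fun s => fE D N (w1 s) * (c * (-s⁻¹))) volume r ρ := by
      apply ContinuousOn.intervalIntegrable
      rwa [uIcc_of_le hr.2]
    have h1 : ∫ s in r..ρ, fE D N (w1 s) * (c * (-s⁻¹)) = w1 ρ - w1 r := by
      apply intervalIntegral.integral_eq_sub_of_hasDerivAt _ hfi
      intro x hx
      rw [uIcc_of_le hr.2] at hx
      exact hw1d x (hr0.trans_le hx.1)
    have h2 : ∫ s in r..ρ, lam * gop D α N w s ≤ ∫ s in r..ρ, -(fE D N (w1 s) * (c * (-s⁻¹))) := by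
      apply intervalIntegral.integral_mono_on hr.2 (hgi r ρ hr0.le hρ.le) hfi.neg
      intro s hs
      have hs' : 0 < s := hr0.trans_le hs.1
      have h3 := hmid s ⟨hr.1.trans hs.1, hs.2⟩
      have hm := mu_pos D α s
      have h4 : lam * gop D α N w s = c / (s * mu D α s) * ((1 - 2 * ε) * α * Sop D α N w s) := by
        rw [hlamdef, gop]; ring
      have h5 : -(fE D N (w1 s) * (c * (-s⁻¹))) =
          c / (s * mu D α s) * (fE D N (w1 s) * mu D α s) := by
        field_simp
      change _ ≤ -(fE D N (w1 s) * (c * (-s⁻¹)))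
      rw [h4, h5]
      gcongr
    rw [intervalIntegral.integral_neg, h1, hw1ρ] at h2
    linarith
  have hE0 : ∀ r ∈ Icc 0 s0, ∫ s in r..s0, lam * gop D α N w s ≤ c * D.f N := by
    intro r hr
    have h1 : ∫ s in r..s0, lam * gop D α N w s ≤ ∫ s in r..s0, (c * α) * (D.f N * s0) := by
      apply intervalIntegral.integral_mono_on hr.2 (hgi r s0 hr.1 hs0.le) (by simp)
      intro x hx
      have hx0 : 0 ≤ x := hr.1.trans hx.1
      have h2 := g_le D hα.le hwa (N := N) (C := D.f N) hx0 (fun t _ => fE_le D hN.le _)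
      have h3 := g_nonneg D α N w hx0
      have h4 : gop D α N w x ≤ D.f N * s0 := h2.trans (by have := hx.2; gcongr)
      gcongr
    rw [intervalIntegral.integral_const, smul_eq_mul] at h1
    refine h1.trans ?_
    calc (s0 - r) * (c * α * (D.f N * s0)) ≤ s0 * (c * α * (D.f N * s0)) := by
          have := hr.1
          gcongr
          linarith
      _ = c * D.f N * (α * s0 ^ 2) := by ring
      _ = c * D.f N := by rw [hαs, mul_one]
  have hcf : 0 < c * D.f N := mul_pos hc hfN
  refine exists_sol D hα.le hN.le hlam hwa (fun r => hWη.le.trans (hwη r)) (fun r => (hwN r).le) ?_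
  intro r
  have hwcl : w (cl r) = w r := by
    have : k (cl r) = k r := by
      simp only [k, cl]
      rcases le_total r 0 with h | h
      · have h1 : max 0 (min r 1) = 0 := max_eq_left ((min_le_left _ _).trans h)
        rw [h1, min_eq_left hρ.le, min_eq_left (h.trans hρ.le), max_eq_left hs0.le,
          max_eq_left (h.trans hs0.le)]
      · rcases le_total r 1 with h' | h'
        · rw [min_eq_left h', max_eq_right h]
        · rw [min_eq_right h', max_eq_right zero_le_one, min_eq_right hρ1.le,
            min_eq_right (hρ1.le.trans h')]
    simp only [w]; rw [this]
  rw [← hwcl]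
  unfold Tmap
  obtain ⟨hx0, hx1⟩ := cl_mem r
  generalize cl r = x at hx0 hx1
  have hc2' : c * D.f N + c * D.f N * ((∫ s in (0:ℝ)..1, D.M s) / ρ) ≤ W η := by linarith
  rcases le_total ρ x with h | h
  · have h1 := hadj ρ x hρ.le hx0
    have h2 : 0 ≤ ∫ s in ρ..x, lam * gop D α N w s := intervalIntegral.integral_nonneg h
      (fun y hy => mul_nonneg hlam.le (g_nonneg D α N w (hρ.le.trans hy.1)))
    have := hwη x
    linarith
  · have h1 := hadj x ρ hx0 hρ.le
    rcases le_total s0 x with h' | h'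
    · have h2 := hEmid x ⟨h', h⟩
      rw [hweq x ⟨h', h⟩]
      linarith
    · have h3 := hEmid s0 ⟨le_rfl, hsρ.le⟩
      have h4 := hE0 x ⟨hx0, h'⟩
      have h5 := hadj x s0 hx0 hs0.le
      have h6 := hadj s0 ρ hs0.le hρ.le
      have h7 : w x = w1 s0 := by
        simp only [w, k]; rw [min_eq_left h, max_eq_left h']
      rw [h7]
      linarith


/-- The value at the origin of any solution of `(P_{α,λ*(α)})`
tends to `∞` as `α → ∞`: for every `M > 0` there is `α₀` such that for all
`α ≥ α₀`, every solution `u` of `(P_{α,λ*(α)})` satisfies `u(0) ≥ M`. -/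
theorem extremal_center_blowup (D : GelfandData) (Mc : ℝ) (hMc : 0 < Mc) :
    ∃ α₀ : ℝ, ∀ α ≥ α₀, ∀ u : ℝ → ℝ,
      IsSolution D α (lamStar D α) u → Mc ≤ u 0 := by
  obtain ⟨N, hNdef⟩ : ∃ N, N = Mc + 1 := ⟨_, rfl⟩
  have hN : 0 < N := by linarith
  obtain ⟨W, hWm, hWc, hWl, hWr, hWd⟩ := exists_W D hN.le
  obtain ⟨A, hA⟩ : ∃ A, A = FE D N Mc := ⟨_, rfl⟩
  obtain ⟨B, hB⟩ : ∃ B, B = FE D N N := ⟨_, rfl⟩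
  have hA0 : 0 < A := by rw [hA, ← FE_zero D N]; exact FE_strictMono D N hMc
  have hAB : A < B := by rw [hA, hB]; exact FE_strictMono D N (by linarith)
  obtain ⟨η, hη⟩ : ∃ η, η = (B - A) / 2 := ⟨_, rfl⟩
  obtain ⟨κ, hκ⟩ : ∃ κ, κ = (A + B) / 2 := ⟨_, rfl⟩
  have hη0 : 0 < η := by linarith
  have hκA : A < κ := by linarith
  have hκ0 : 0 < κ := by linarith
  obtain ⟨ε, hε⟩ : ∃ ε, ε = (κ - A) / (8 * κ) := ⟨_, rfl⟩
  have hε0 : 0 < ε := by rw [hε]; exact div_pos (by linarith) (by linarith)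
  have hεκ : 8 * (ε * κ) = κ - A := by rw [hε]; field_simp
  have hε8 : ε < 1 / 8 := by
    rw [hε, div_lt_div_iff₀ (by linarith) (by norm_num)]; linarith
  obtain ⟨ρ, ⟨hρφ, hρψ⟩, hρ0, hρ1⟩ : ∃ ρ, (1 - ε < phiE D ρ ∧ 1 - ε < psiE D ρ) ∧ 0 < ρ ∧ ρ < 1 := by
    have h1 : ∀ᶠ t in nhds (0:ℝ), 1 - ε < phiE D t :=
      (phiE_cont D).continuousAt.eventually (lt_mem_nhds (by rw [phiE_zero]; linarith))
    have h2 : ∀ᶠ t in nhds (0:ℝ), 1 - ε < psiE D t :=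
      (psiE_cont D).continuousAt.eventually (lt_mem_nhds (by rw [psiE_zero]; linarith))
    have h3 : ∀ᶠ t in nhdsWithin (0:ℝ) (Ioi 0), 1 - ε < phiE D t ∧ 1 - ε < psiE D t :=
      nhdsWithin_le_nhds (h1.and h2)
    obtain ⟨t, ht1, ht2⟩ := (h3.and (Ioo_mem_nhdsGT one_pos)).exists
    exact ⟨t, ht1, ht2⟩
  obtain ⟨R, hR⟩ : ∃ R, R = 2 / ε := ⟨_, rfl⟩
  have hR0 : 0 < R := by rw [hR]; positivity
  have hR1 : 1 ≤ R := by rw [hR, le_div_iff₀ hε0]; linarith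
  have hc0 : Tendsto (fun α : ℝ => 2 * κ / Real.log α) atTop (nhds 0) :=
    tendsto_const_nhds.div_atTop Real.tendsto_log_atTop
  have hWη : 0 < W η := by
    have h0 : W 0 = 0 := by have := hWr 0; rwa [FE_zero] at this
    rw [← h0]; exact hWm hη0
  have hsm : ∀ K δ : ℝ, 0 < δ → ∀ᶠ α : ℝ in atTop, 2 * κ / Real.log α * K < δ := by
    intro K δ hδ
    have := hc0.mul_const K
    rw [zero_mul] at this
    exact this.eventually (gt_mem_nhds hδ)
  have hsq : ∀ᶠ α : ℝ in atTop, R / ρ < Real.sqrt α :=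
    Real.tendsto_sqrt_atTop.eventually (eventually_gt_atTop _)
  apply eventually_atTop.1
  filter_upwards [hsm (D.f (N + 1)) ε hε0,
    hsm (D.f N * (1 + (∫ s in (0:ℝ)..1, D.M s) / ρ)) (W η) hWη,
    hsm (Real.log R - Real.log ρ) ((κ - A) / 2) (by linarith), hsq,
    eventually_gt_atTop (1:ℝ)] with α h1 h2 h3 h4 hα1 u hu
  by_contra hlt
  push Not at hlt
  have hα : 0 < α := by linarith
  have hlog : 0 < Real.log α := Real.log_pos hα1
  have hsα : 0 < Real.sqrt α := Real.sqrt_pos.2 hα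
  have hsα2 : Real.sqrt α ^ 2 = α := Real.sq_sqrt hα.le
  have hls : Real.log (Real.sqrt α) = Real.log α / 2 := Real.log_sqrt hα.le
  obtain ⟨c, hc⟩ : ∃ c, c = 2 * κ / Real.log α := ⟨_, rfl⟩
  rw [← hc] at h1 h2 h3
  have hcp : 0 < c := by rw [hc]; positivity
  have hcl : c * (Real.log α / 2) = κ := by rw [hc]; field_simp
  have haρ : R / Real.sqrt α < ρ := by
    rw [div_lt_iff₀ hρ0] at h4
    rw [div_lt_iff₀ hsα]; linarith
  have hsρ : 1 / Real.sqrt α < ρ := lt_of_le_of_lt (by gcongr) haρ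
  have hsol : ∃ u, IsSolution D α ((1 - 2 * ε) * c * α) u := by
    refine super_exists D (s0 := 1 / Real.sqrt α) hα hN hWm hWc hWr hWd hρ1 (by positivity) ?_ hsρ hε0 (by linarith)
      hρφ.le hcp hη0 ?_ h1.le (by linarith)
    · rw [div_pow, hsα2]; field_simp
    · rw [Real.log_div hρ0.ne' (by positivity), one_div, Real.log_inv, hls, ← hB]
      have : Real.log ρ < 0 := Real.log_neg hρ0 hρ1
      have := mul_neg_of_pos_of_neg hcp this
      linarith
  have hmem : (1 - 2 * ε) * c * α ∈ solvableSet D α :=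
    ⟨mul_pos (mul_pos (by linarith) hcp) hα, hsol⟩
  have hle : (1 - 2 * ε) * c * α ≤ lamStar D α := by
    by_cases hbd : BddAbove (solvableSet D α)
    · exact le_csSup hbd hmem
    · exfalso
      have : lamStar D α = 0 := Real.sSup_of_not_bddAbove hbd
      rw [this] at hu
      exact not_sol_zero D hu
  have hl0 : 0 ≤ lamStar D α := hmem.1.le.trans hle
  have hup := sol_upper D hα hl0 hu (N := N) (by linarith) (a := R / Real.sqrt α) (b := ρ) (ε := ε)
    (by positivity) haρ hρ1 hε0 (by linarith) hρψ.le (by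
      refine le_trans ?_ (mu_lower D hα (by positivity) ?_)
      · rw [div_pow, hsα2, hR]
        rw [show α * ((2 / ε) ^ 2 / α) / 4 = 1 / ε ^ 2 by field_simp; norm_num]
        apply one_div_le_one_div_of_le (by positivity)
        nlinarith
      · have := phiE_anti D haρ.le
        linarith)
  have hFA : FE D N (u 0) ≤ A := by rw [hA]; exact (FE_strictMono D N).monotone hlt.le
  rw [Real.log_div hρ0.ne' (by positivity), Real.log_div hR0.ne' hsα.ne', hls] at hup
  have hlogpos : 0 ≤ Real.log ρ - (Real.log R - Real.log α / 2) := by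
    have := Real.log_le_log (by positivity) haρ.le
    rw [Real.log_div hR0.ne' hsα.ne', hls] at this
    linarith
  have hdiv : (1 - 2 * ε) * c ≤ lamStar D α / α := by
    rw [le_div_iff₀ hα]; exact hle
  have h5 : (1 - 2 * ε) * c * (1 - ε) ^ 2 * (Real.log ρ - (Real.log R - Real.log α / 2)) ≤ A := by
    refine le_trans ?_ (hup.trans hFA)
    gcongr
  have h6 : c * (Real.log ρ - (Real.log R - Real.log α / 2)) =
      κ - c * (Real.log R - Real.log ρ) := by rw [← hcl]; ring
  have h7 : κ - (κ - A) / 2 < c * (Real.log ρ - (Real.log R - Real.log α / 2)) := by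
    rw [h6]; linarith
  set X := c * (Real.log ρ - (Real.log R - Real.log α / 2)) with hX
  have h8 : (1 - 2 * ε) * (1 - ε) ^ 2 * X ≤ A := by rw [hX]; linarith
  have h9 : 1 - 4 * ε ≤ (1 - 2 * ε) * (1 - ε) ^ 2 := by
    have e1 : (1 - 2 * ε) * (1 - ε) ^ 2 = 1 - 4 * ε + ε ^ 2 * (5 - 2 * ε) := by ring
    have e2 : 0 ≤ ε ^ 2 * (5 - 2 * ε) := mul_nonneg (sq_nonneg ε) (by linarith)
    linarith
  have hX0 : 0 < X := by linarith
  have h10 : (1 - 4 * ε) * X ≤ A := (mul_le_mul_of_nonneg_right h9 hX0.le).trans h8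
  have h11 : (1 - 4 * ε) * (κ - (κ - A) / 2) ≤ (1 - 4 * ε) * X :=
    mul_le_mul_of_nonneg_left h7.le (by linarith)
  have h12 : ε * A < ε * κ := mul_lt_mul_of_pos_left hκA hε0
  have h13 : (1 - 4 * ε) * (κ - (κ - A) / 2) = (κ + A) / 2 - 2 * (ε * κ) - 2 * (ε * A) := by ring
  linarith
end

section
/- Fix constants c > 0 and γ > 0. Then there exists α₀ such that for all α ≥ α₀, every θ > 0 satisfying f(θ)/θ = c log α satisfies θ ≤ α^γ. In particular the largest solution θ*(α) of the equation f(θ)/θ = c log α satisfies θ*(α) ≤ α^γ for all sufficiently large α. -/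
open Set MeasureTheory Filter

/-- For fixed `c, γ > 0` there is `α₀` such that for all `α ≥ α₀`,
every `θ > 0` with `f(θ)/θ = c log α` satisfies `θ ≤ α^γ`. -/
theorem theta_bound (f : ℝ → ℝ) (hf_pos : ∀ s, 0 ≤ s → 0 < f s)
    (hf_smooth : ContDiffOn ℝ 1 f (Ici 0)) (hf_convex : ConvexOn ℝ (Ici 0) f)
    (hf_mono : MonotoneOn f (Ici 0))
    (hf_int : IntegrableOn (fun s => 1 / f s) (Ioi 0))
    (c γ : ℝ) (hc : 0 < c) (hγ : 0 < γ) :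
    ∃ α₀ : ℝ, ∀ α ≥ α₀, ∀ θ > (0:ℝ),
      f θ / θ = c * Real.log α → θ ≤ α ^ γ := by
  have h0 := hf_pos 0 le_rfl
  have hnn : ∀ s : ℝ, 0 ≤ s → 0 ≤ 1 / f s := fun s hs => (one_div_pos.2 (hf_pos s hs)).le
  have hε : 0 < γ / (2 * c) := by positivity
  have hlim := intervalIntegral_tendsto_integral_Ioi (0:ℝ) hf_int tendsto_id
  obtain ⟨a, haK, ha1⟩ := ((hlim.eventually (lt_mem_nhds (sub_lt_self
    (∫ s in Ioi (0:ℝ), 1 / f s) hε))).and (eventually_ge_atTop (1:ℝ))).exists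
  simp only [id] at haK
  have ha0 : 0 < a := by linarith
  have hla : 0 ≤ Real.log a := Real.log_nonneg ha1
  have hii : ∀ x y : ℝ, 0 ≤ x → x ≤ y → IntervalIntegrable (fun s => 1 / f s) volume x y := by
    intro x y hx hxy
    rw [intervalIntegrable_iff_integrableOn_Ioc_of_le hxy]
    exact hf_int.mono_set fun z hz => lt_of_le_of_lt hx hz.1
  refine ⟨Real.exp ((2 / γ) * (Real.log a + γ * f 0 / (2 * c)) + 1), fun α hα θ hθ heq => ?_⟩
  have hαpos : 0 < α := lt_of_lt_of_le (Real.exp_pos _) hα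
  have hL := (Real.le_log_iff_exp_le hαpos).2 hα
  set L := Real.log α with hLdef
  have hL2 : Real.log a + γ * f 0 / (2 * c) < γ / 2 * L := by
    have h1 : (2 / γ) * (Real.log a + γ * f 0 / (2 * c)) < L := by linarith
    have h2 := mul_lt_mul_of_pos_left h1 (half_pos hγ)
    have h3 : γ / 2 * ((2 / γ) * (Real.log a + γ * f 0 / (2 * c)))
      = Real.log a + γ * f 0 / (2 * c) := by field_simp
    linarith
  have hq : 0 < γ * f 0 / (2 * c) := by positivity
  have hLpos : 0 < L := by
    by_contra h
    push Not at h
    have := mul_nonpos_of_nonneg_of_nonpos (half_pos hγ).le h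
    linarith
  by_contra hcon
  push Not at hcon
  have hlogθ : γ * L < Real.log θ := by
    rw [hLdef, ← Real.log_rpow hαpos]
    exact Real.log_lt_log (Real.rpow_pos_of_pos hαpos _) hcon
  have haθ : a < θ := by
    rw [← Real.log_lt_log_iff ha0 hθ]
    nlinarith
  have hfθ : f θ = c * L * θ := by
    rw [div_eq_iff hθ.ne'] at heq
    exact heq
  have hD : 0 < f 0 + c * L := by positivity
  have hbd : ∀ s ∈ Icc a θ, (f 0 + c * L)⁻¹ * s⁻¹ ≤ 1 / f s := by
    intro s hs
    have hs1 : 1 ≤ s := ha1.trans hs.1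
    have hs0 : 0 < s := by linarith
    have hsθ : s / θ ≤ 1 := (div_le_one hθ).2 hs.2
    have hcv := hf_convex.2 (mem_Ici.2 (le_refl (0:ℝ))) (mem_Ici.2 hθ.le)
      (show 0 ≤ 1 - s / θ by linarith) (show 0 ≤ s / θ by positivity) (by ring)
    simp only [smul_eq_mul, mul_zero, zero_add] at hcv
    rw [div_mul_cancel₀ _ hθ.ne', hfθ] at hcv
    have e : s / θ * (c * L * θ) = c * L * s := by field_simp
    rw [e] at hcv
    have hp : 0 ≤ s / θ * f 0 := by positivity
    have : f s ≤ (f 0 + c * L) * s := by nlinarith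
    rw [← mul_inv, ← one_div]
    exact one_div_le_one_div_of_le (hf_pos s hs0.le) this
  have hinv : IntervalIntegrable (fun s : ℝ => (f 0 + c * L)⁻¹ * s⁻¹) volume a θ := by
    apply ContinuousOn.intervalIntegrable
    rw [uIcc_of_le haθ.le]
    refine continuousOn_const.mul (continuousOn_id.inv₀ fun x hx => ?_)
    exact (lt_of_lt_of_le ha0 hx.1).ne'
  have hI := intervalIntegral.integral_mono_on haθ.le hinv (hii a θ ha0.le haθ.le) hbd
  rw [intervalIntegral.integral_const_mul, integral_inv_of_pos ha0 hθ,
    Real.log_div hθ.ne' ha0.ne'] at hI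
  have hadd := intervalIntegral.integral_add_adjacent_intervals
    (hii 0 a le_rfl ha0.le) (hii a θ ha0.le haθ.le)
  have hle : ∫ s in (0:ℝ)..θ, 1 / f s ≤ ∫ s in Ioi (0:ℝ), 1 / f s := by
    rw [intervalIntegral.integral_of_le hθ.le]
    refine setIntegral_mono_set hf_int ?_ (Ioc_subset_Ioi_self.eventuallyLE)
    filter_upwards [ae_restrict_mem measurableSet_Ioi] with s hs
    exact hnn s (le_of_lt hs)
  have hfin : (f 0 + c * L)⁻¹ * (Real.log θ - Real.log a) < γ / (2 * c) := by linarith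
  rw [inv_mul_lt_iff₀ hD] at hfin
  have e : (f 0 + c * L) * (γ / (2 * c)) = γ * f 0 / (2 * c) + γ / 2 * L := by field_simp
  linarith
end

section
/- Let f : (0,∞) → (0,∞) be a C² function with f'(s) > 0 and f''(s) > 0 for all s > 0, such that f'' is strictly increasing on (0,∞). Then there exist constants c₀ ∈ (0,1), c₁ > 1 and t₀ > 0 such that for all t₂ > t₁ > t₀, the inequality f(t₂) ≥ c₁ f(t₁) implies (1 − c₀) f'(t₂) ≥ f'(t₁). (In fact one may take c₁ = 4 and c₀ = 1/3.) -/
open Set MeasureTheory Filter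

/-- If `f : (0,∞) → (0,∞)` is `C²` with `f' > 0`, `f'' > 0`, and
`f''` strictly increasing on `(0,∞)`, then there are `c₀ ∈ (0,1)`, `c₁ > 1`, `t₀ > 0`
such that for all `t₂ > t₁ > t₀`, `f(t₂) ≥ c₁ f(t₁)` implies
`(1 - c₀) f'(t₂) ≥ f'(t₁)`. -/
theorem convexity_growth_criterion (f : ℝ → ℝ)
    (hpos : ∀ s > (0:ℝ), 0 < f s)
    (hsmooth : ContDiffOn ℝ 2 f (Ioi 0))
    (hd1 : ∀ s > (0:ℝ), 0 < deriv f s)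
    (hd2 : ∀ s > (0:ℝ), 0 < deriv (deriv f) s)
    (hd2mono : StrictMonoOn (deriv (deriv f)) (Ioi 0)) :
    ∃ c0 ∈ Ioo (0:ℝ) 1, ∃ c1 > (1:ℝ), ∃ t0 > (0:ℝ),
      ∀ t1 t2 : ℝ, t0 < t1 → t1 < t2 → c1 * f t1 ≤ f t2 →
        deriv f t1 ≤ (1 - c0) * deriv f t2 := by
  have hC1 : ContDiffOn ℝ 1 (deriv f) (Ioi 0) :=
    hsmooth.deriv_of_isOpen isOpen_Ioi (by norm_num)
  have hfd : ∀ s > (0:ℝ), DifferentiableAt ℝ f s := fun s hs =>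
    (hsmooth.differentiableOn (by norm_num)).differentiableAt (Ioi_mem_nhds hs)
  have hgd : ∀ s > (0:ℝ), DifferentiableAt ℝ (deriv f) s := fun s hs =>
    (hC1.differentiableOn (by norm_num)).differentiableAt (Ioi_mem_nhds hs)
  have mvt : ∀ g : ℝ → ℝ, (∀ s > (0:ℝ), DifferentiableAt ℝ g s) → ∀ x y, 0 < x → x < y →
      ∃ c, x < c ∧ c < y ∧ g y - g x = deriv g c * (y - x) := by
    intro g hg x y hx hxy
    obtain ⟨c, hc, h⟩ := exists_deriv_eq_slope g hxy
      (fun z hz => (hg z (lt_of_lt_of_le hx hz.1)).continuousAt.continuousWithinAt)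
      (fun z hz => (hg z (lt_trans hx hz.1)).differentiableWithinAt)
    refine ⟨c, hc.1, hc.2, ?_⟩
    have : y - x ≠ 0 := by linarith
    rw [h]; field_simp
  have key : ∀ g : ℝ → ℝ, (∀ s > (0:ℝ), DifferentiableAt ℝ g s) →
      StrictMonoOn (deriv g) (Ioi 0) → ∀ x y, 0 < x → x < y →
      deriv g x * (y - x) ≤ g y - g x ∧ g y - g x ≤ deriv g y * (y - x) := by
    intro g hg hm x y hx hxy
    obtain ⟨c, h1, h2, h⟩ := mvt g hg x y hx hxy
    have hc : 0 < c := hx.trans h1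
    have hy : 0 < y := hx.trans hxy
    have a1 := hm (mem_Ioi.2 hx) (mem_Ioi.2 hc) h1
    have a2 := hm (mem_Ioi.2 hc) (mem_Ioi.2 hy) h2
    rw [h]
    exact ⟨mul_le_mul_of_nonneg_right a1.le (by linarith),
      mul_le_mul_of_nonneg_right a2.le (by linarith)⟩
  have hmono : StrictMonoOn (deriv f) (Ioi 0) := by
    intro x hx y hy hxy
    obtain ⟨c, h1, h2, h⟩ := mvt _ hgd x y hx hxy
    have hx' : 0 < x := hx
    have := mul_pos (hd2 c (hx'.trans h1)) (sub_pos.2 hxy)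
    linarith
  have K1 := key f hfd hmono
  have K2 := key (deriv f) hgd hd2mono
  have p1 := hd1 1 one_pos
  have p2 := hd2 1 one_pos
  have pq := div_pos p1 p2
  refine ⟨1/3, ⟨by norm_num, by norm_num⟩, 4, by norm_num, 1 + deriv f 1 / deriv (deriv f) 1,
    by linarith, ?_⟩
  intro t1 t2 h1 h12 hf
  have ht1 : 1 < t1 := by linarith
  have ht0 : 0 < t1 := by linarith
  have hm := hd2 t1 ht0
  have ha := hd1 t1 ht0
  have A := (K2 t1 t2 ht0 h12).1
  have B := K2 1 t1 one_pos ht1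
  by_contra hcon
  push Not at hcon
  rcases le_or_gt (t1 - 1) (t2 - t1) with hL | hL
  · have C : deriv f 1 < deriv (deriv f) 1 * (t1 - 1) := by
      have : deriv f 1 / deriv (deriv f) 1 < t1 - 1 := by linarith
      rw [div_lt_iff₀ p2] at this
      linarith
    have D := mul_le_mul_of_nonneg_left hL hm.le
    linarith [B.1, B.2]
  · have hs : 0 < t1 - (t2 - t1) := by linarith
    have hst : t1 - (t2 - t1) < t1 := by linarith
    have D := (K2 _ _ hs hst).2
    have E := (K1 _ _ hs hst).1
    have F := (K1 _ _ ht0 h12).2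
    have G := hpos _ hs
    have hl : 0 < t2 - t1 := by linarith
    rw [sub_sub_cancel] at D E
    have H : deriv f t1 / 2 < deriv f (t1 - (t2 - t1)) := by linarith
    have H' := mul_lt_mul_of_pos_right H hl
    have I := mul_lt_mul_of_pos_right hcon hl
    nlinarith
end
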